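/- Imitation error bound (equations (117)–(118) in the proof of Theorem 1). Let π and π' be two policies with π'(a|s) > 0 for all (s,a), and let ν be a probability mass function on S. Suppose there exists M > 0 such that d^{π}(s) ≤ M·ν(s) for all s ∈ S, where d^{π} is the discounted state occupancy of π with respect to an initial distribution ρ0. Then V^{π'}(ρ0) − V^{π}(ρ0) ≤ (√(2M)·R_max/(1−γ)²)·√(Σ_s ν(s)·KL(π(·|s) ‖ π'(·|s))). -/

import Mathlib

/-- KL divergence between two probability mass functions on a finite set
(with the convention `0 · log 0 = 0`, which holds for `Real.log`). -/
noncomputable def KLdiv {α : Type*} [Fintype α] (p q : α → ℝ) : ℝ :=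
  ∑ a, p a * Real.log (p a / q a)

section Pinsker

theorem hasDerivAt_log_sub_pade {x : ℝ} (hx : 0 < x) :
    HasDerivAt (fun x : ℝ => Real.log x - (x - 1) * (5 * x + 1) / (2 * x * (x + 2)))
      ((x - 1) ^ 3 / (x ^ 2 * (x + 2) ^ 2)) x := by
  have hid := hasDerivAt_id' x
  have hden : 2 * x * (x + 2) ≠ 0 := by positivity
  have h := (Real.hasDerivAt_log hx.ne').sub
    (((hid.sub_const 1).mul ((hid.const_mul 5).add_const 1)).div
      ((hid.const_mul 2).mul (hid.add_const 2)) hden)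
  refine h.congr_deriv ?_
  simp only [Pi.mul_apply]
  field_simp
  ring

theorem pade_le_log {x : ℝ} (hx : 0 < x) :
    (x - 1) * (5 * x + 1) / (2 * x * (x + 2)) ≤ Real.log x := by
  set g : ℝ → ℝ := fun x => Real.log x - (x - 1) * (5 * x + 1) / (2 * x * (x + 2)) with hg
  have hderiv : ∀ y : ℝ, 0 < y → HasDerivAt g ((y - 1) ^ 3 / (y ^ 2 * (y + 2) ^ 2)) y :=
    fun y hy => hasDerivAt_log_sub_pade hy
  have hg1 : g 1 = 0 := by simp [hg]
  suffices h : g 1 ≤ g x by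
    rw [hg1] at h
    exact sub_nonneg.mp h
  rcases le_total x 1 with h | h
  · have hanti : AntitoneOn g (Set.Icc x 1) := by
      apply antitoneOn_of_deriv_nonpos (convex_Icc x 1)
      · exact fun y hy => (hderiv y (hx.trans_le hy.1)).continuousAt.continuousWithinAt
      · intro y hy
        rw [interior_Icc] at hy
        exact (hderiv y (hx.trans hy.1)).differentiableAt.differentiableWithinAt
      · intro y hy
        rw [interior_Icc] at hy
        rw [(hderiv y (hx.trans hy.1)).deriv]
        refine div_nonpos_of_nonpos_of_nonneg ?_ (by positivity)
        exact (Odd.pow_nonpos (by decide) (by linarith [hy.2]))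
    exact hanti ⟨le_rfl, h⟩ ⟨h, le_rfl⟩ h
  · have hmono : MonotoneOn g (Set.Icc 1 x) := by
      apply monotoneOn_of_deriv_nonneg (convex_Icc 1 x)
      · exact fun y hy =>
          (hderiv y (one_pos.trans_le hy.1)).continuousAt.continuousWithinAt
      · intro y hy
        rw [interior_Icc] at hy
        exact (hderiv y (one_pos.trans hy.1)).differentiableAt.differentiableWithinAt
      · intro y hy
        rw [interior_Icc] at hy
        rw [(hderiv y (one_pos.trans hy.1)).deriv]
        have : 0 ≤ y - 1 := by linarith [hy.1]
        positivity
    exact hmono ⟨le_rfl, h⟩ ⟨h, le_rfl⟩ h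

theorem sq_sub_le_mul_log_div {p q : ℝ} (hp : 0 ≤ p) (hq : 0 < q) :
    (p - q) ^ 2 ≤ (2 * p + 4 * q) / 3 * (p * Real.log (p / q) - p + q) := by
  rcases hp.eq_or_lt with rfl | hp
  · simp only [zero_mul]
    nlinarith [sq_nonneg q]
  · have h := mul_le_mul_of_nonneg_left (pade_le_log (div_pos hp hq)) hp.le
    have heq : p * ((p / q - 1) * (5 * (p / q) + 1) / (2 * (p / q) * (p / q + 2))) - p + q
        = (p - q) ^ 2 / ((2 * p + 4 * q) / 3) := by
      field_simp
      ring
    have hpos : 0 < (2 * p + 4 * q) / 3 := by positivity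
    rw [← div_le_iff₀' hpos, ← heq]
    linarith

/-- Pinsker's inequality on a finite set. -/
theorem sq_sum_abs_sub_le_two_mul_KLdiv {α : Type*} [Fintype α] {p q : α → ℝ}
    (hp : ∀ a, 0 ≤ p a) (hq : ∀ a, 0 < q a) (hp_sum : ∑ a, p a = 1) (hq_sum : ∑ a, q a = 1) :
    (∑ a, |p a - q a|) ^ 2 ≤ 2 * KLdiv p q := by
  have hterm : ∀ a, (p a - q a) ^ 2 / ((2 * p a + 4 * q a) / 3) ≤
      p a * Real.log (p a / q a) - p a + q a := fun a => by
    have hpos : 0 < (2 * p a + 4 * q a) / 3 := by linarith [hp a, hq a]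
    rw [div_le_iff₀' hpos]
    exact sq_sub_le_mul_log_div (hp a) (hq a)
  have hpos : ∀ a, 0 < (2 * p a + 4 * q a) / 3 := fun a => by linarith [hp a, hq a]
  have hcs := Finset.sum_sq_le_sum_mul_sum_of_sq_le_mul Finset.univ
    (r := fun a => |p a - q a|) (f := fun a => (2 * p a + 4 * q a) / 3)
    (g := fun a => (p a - q a) ^ 2 / ((2 * p a + 4 * q a) / 3))
    (fun a _ => (hpos a).le) (fun a _ => div_nonneg (sq_nonneg _) (hpos a).le)
    (fun a _ => by rw [sq_abs, mul_div_cancel₀ _ (hpos a).ne'])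
  have htwo : ∑ a, (2 * p a + 4 * q a) / 3 = 2 := by
    rw [← Finset.sum_div, Finset.sum_add_distrib, ← Finset.mul_sum, ← Finset.mul_sum,
      hp_sum, hq_sum]
    norm_num
  have hKL : ∑ a, (p a * Real.log (p a / q a) - p a + q a) = KLdiv p q := by
    rw [Finset.sum_add_distrib, Finset.sum_sub_distrib, hp_sum, hq_sum, KLdiv]
    ring
  rw [htwo] at hcs
  rw [← hKL]
  exact hcs.trans (mul_le_mul_of_nonneg_left (Finset.sum_le_sum fun a _ => hterm a) two_pos.le)

end Pinsker

theorem abs_sum_mul_le_of_abs_le {α : Type*} [Fintype α] {p f : α → ℝ} {C : ℝ}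
    (hp : ∀ a, 0 ≤ p a) (hp_sum : ∑ a, p a = 1) (hf : ∀ a, |f a| ≤ C) :
    |∑ a, p a * f a| ≤ C := by
  calc |∑ a, p a * f a| ≤ ∑ a, |p a * f a| := Finset.abs_sum_le_sum_abs _ _
    _ ≤ ∑ a, p a * C := Finset.sum_le_sum fun a _ => by
        rw [abs_mul, abs_of_nonneg (hp a)]
        exact mul_le_mul_of_nonneg_left (hf a) (hp a)
    _ = C := by rw [← Finset.sum_mul, hp_sum, one_mul]

section MarkovDecisionProcess

variable {S A : Type*} [Fintype S] [Fintype A]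

theorem abs_value_le [Nonempty S] {P : S → A → S → ℝ}
    (hP_nonneg : ∀ s a s', 0 ≤ P s a s') (hP_sum : ∀ s a, ∑ s', P s a s' = 1)
    {r : S → A → ℝ} {R γ : ℝ} (hr : ∀ s a, |r s a| ≤ R) (hγ0 : 0 ≤ γ) (hγ1 : γ < 1)
    {π : S → A → ℝ} (hπ_nonneg : ∀ s a, 0 ≤ π s a) (hπ_sum : ∀ s, ∑ a, π s a = 1)
    {V : S → ℝ} (hV : ∀ s, V s = ∑ a, π s a * (r s a + γ * ∑ s', P s a s' * V s')) (s : S) :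
    |V s| ≤ R / (1 - γ) := by
  obtain ⟨s₀, hs₀⟩ := Finite.exists_max fun s => |V s|
  have hmax : |V s₀| ≤ R + γ * |V s₀| := by
    conv_lhs => rw [hV s₀]
    refine abs_sum_mul_le_of_abs_le (hπ_nonneg s₀) (hπ_sum s₀) fun a => ?_
    refine (abs_add_le _ _).trans (add_le_add (hr s₀ a) ?_)
    rw [abs_mul, abs_of_nonneg hγ0]
    exact mul_le_mul_of_nonneg_left
      (abs_sum_mul_le_of_abs_le (hP_nonneg s₀ a) (hP_sum s₀ a) hs₀) hγ0
  refine (hs₀ s).trans ?_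
  rw [le_div_iff₀ (by linarith)]
  linarith

/-- The occupancy equation tested against a function on states. -/
theorem occupancy_pairing {P : S → A → S → ℝ} {γ : ℝ} {π : S → A → ℝ} {ρ d : S → ℝ}
    (hd : ∀ s', d s' = (1 - γ) * ρ s' + γ * ∑ s, ∑ a, d s * π s a * P s a s') (f : S → ℝ) :
    ∑ s, d s * f s =
      (1 - γ) * ∑ s, ρ s * f s + γ * ∑ s, d s * ∑ a, π s a * ∑ s', P s a s' * f s' := by
  have hswap : ∑ s', (∑ s, ∑ a, d s * π s a * P s a s') * f s' =
      ∑ s, d s * ∑ a, π s a * ∑ s', P s a s' * f s' := by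
    simp only [Finset.sum_mul, Finset.mul_sum]
    rw [Finset.sum_comm]
    refine Finset.sum_congr rfl fun s _ => ?_
    rw [Finset.sum_comm]
    exact Finset.sum_congr rfl fun a _ => Finset.sum_congr rfl fun s' _ => by ring
  rw [← hswap, Finset.mul_sum, Finset.mul_sum, ← Finset.sum_add_distrib]
  refine Finset.sum_congr rfl fun s _ => ?_
  conv_lhs => rw [hd s]
  ring

theorem occupancy_sum {P : S → A → S → ℝ} (hP_sum : ∀ s a, ∑ s', P s a s' = 1)
    {γ : ℝ} (hγ1 : γ < 1) {π : S → A → ℝ} (hπ_sum : ∀ s, ∑ a, π s a = 1)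
    {ρ d : S → ℝ} (hρ_sum : ∑ s, ρ s = 1)
    (hd : ∀ s', d s' = (1 - γ) * ρ s' + γ * ∑ s, ∑ a, d s * π s a * P s a s') :
    ∑ s, d s = 1 := by
  have h := occupancy_pairing hd fun _ => 1
  simp only [mul_one, hP_sum, hπ_sum, hρ_sum] at h
  have h' : (1 - γ) * (∑ s, d s - 1) = 0 := by linarith
  rcases mul_eq_zero.mp h' with h' | h' <;> linarith

theorem occupancy_nonneg {P : S → A → S → ℝ}
    (hP_nonneg : ∀ s a s', 0 ≤ P s a s') (hP_sum : ∀ s a, ∑ s', P s a s' = 1)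
    {γ : ℝ} (hγ0 : 0 ≤ γ) (hγ1 : γ < 1)
    {π : S → A → ℝ} (hπ_nonneg : ∀ s a, 0 ≤ π s a) (hπ_sum : ∀ s, ∑ a, π s a = 1)
    {ρ d : S → ℝ} (hρ_nonneg : ∀ s, 0 ≤ ρ s) (hρ_sum : ∑ s, ρ s = 1)
    (hd : ∀ s', d s' = (1 - γ) * ρ s' + γ * ∑ s, ∑ a, d s * π s a * P s a s') (s : S) :
    0 ≤ d s := by
  have habs : ∀ s', |d s'| ≤ (1 - γ) * ρ s' + γ * ∑ s, ∑ a, |d s| * π s a * P s a s' := by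
    intro s'
    conv_lhs => rw [hd s']
    refine (abs_add_le _ _).trans (add_le_add ?_ ?_)
    · rw [abs_of_nonneg (mul_nonneg (by linarith) (hρ_nonneg s'))]
    · rw [abs_mul, abs_of_nonneg hγ0]
      refine mul_le_mul_of_nonneg_left ?_ hγ0
      refine (Finset.abs_sum_le_sum_abs _ _).trans (Finset.sum_le_sum fun s _ => ?_)
      refine (Finset.abs_sum_le_sum_abs _ _).trans (Finset.sum_le_sum fun a _ => ?_)
      rw [abs_mul, abs_mul, abs_of_nonneg (hπ_nonneg s a), abs_of_nonneg (hP_nonneg s a s')]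
  have hflow : ∑ s', ∑ s, ∑ a, |d s| * π s a * P s a s' = ∑ s, |d s| := by
    rw [Finset.sum_comm]
    refine Finset.sum_congr rfl fun s _ => ?_
    rw [Finset.sum_comm]
    simp only [← Finset.mul_sum, hP_sum, hπ_sum, mul_one]
  have hle : ∑ s, |d s| ≤ 1 := by
    have h := Finset.sum_le_sum fun s' (_ : s' ∈ Finset.univ) => habs s'
    rw [Finset.sum_add_distrib, ← Finset.mul_sum, ← Finset.mul_sum, hflow, hρ_sum] at h
    by_contra! hlt
    nlinarith
  have hzero : ∑ s, (|d s| - d s) = 0 := by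
    refine le_antisymm ?_ (Finset.sum_nonneg fun s _ => sub_nonneg.mpr (le_abs_self _))
    rw [Finset.sum_sub_distrib, occupancy_sum hP_sum hγ1 hπ_sum hρ_sum hd]
    linarith
  have h := (Finset.sum_eq_zero_iff_of_nonneg
    fun s _ => sub_nonneg.mpr (le_abs_self (d s))).mp hzero s (Finset.mem_univ s)
  linarith [abs_nonneg (d s)]

/-- The performance difference identity. -/
theorem performance_difference {P : S → A → S → ℝ} {r : S → A → ℝ} {γ : ℝ}
    {π π' : S → A → ℝ} {V V' ρ d : S → ℝ}
    (hV : ∀ s, V s = ∑ a, π s a * (r s a + γ * ∑ s', P s a s' * V s'))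
    (hV' : ∀ s, V' s = ∑ a, π' s a * (r s a + γ * ∑ s', P s a s' * V' s'))
    (hd : ∀ s', d s' = (1 - γ) * ρ s' + γ * ∑ s, ∑ a, d s * π s a * P s a s') :
    (1 - γ) * (∑ s, ρ s * V' s - ∑ s, ρ s * V s) =
      ∑ s, d s * ∑ a, (π' s a - π s a) * (r s a + γ * ∑ s', P s a s' * V' s') := by
  have hdiff : ∀ s, V' s - V s =
      ∑ a, (π' s a - π s a) * (r s a + γ * ∑ s', P s a s' * V' s') +
        γ * ∑ a, π s a * ∑ s', P s a s' * (V' s' - V s') := by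
    intro s
    conv_lhs => rw [hV' s, hV s]
    rw [Finset.mul_sum, ← Finset.sum_sub_distrib, ← Finset.sum_add_distrib]
    refine Finset.sum_congr rfl fun a _ => ?_
    simp only [mul_sub, Finset.sum_sub_distrib]
    ring
  have hpair := occupancy_pairing hd fun s => V' s - V s
  have hsum : ∑ s, d s * (V' s - V s) =
      ∑ s, d s * ∑ a, (π' s a - π s a) * (r s a + γ * ∑ s', P s a s' * V' s') +
        γ * ∑ s, d s * ∑ a, π s a * ∑ s', P s a s' * (V' s' - V s') := by
    rw [Finset.mul_sum, ← Finset.sum_add_distrib]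
    refine Finset.sum_congr rfl fun s _ => ?_
    conv_lhs => rw [hdiff s]
    ring
  have hρ : ∑ s, ρ s * (V' s - V s) = ∑ s, ρ s * V' s - ∑ s, ρ s * V s := by
    simp only [mul_sub, Finset.sum_sub_distrib]
  rw [← hρ]
  linarith

end MarkovDecisionProcess

/-- Imitation error bound (equations (117)–(118)): if `d^π(s) ≤ M·ν(s)` for all `s`,
then `V^{π'}(ρ0) − V^{π}(ρ0) ≤ (√(2M)·R_max/(1−γ)²)·√(Σ_s ν(s)·KL(π(·|s) ‖ π'(·|s)))`. -/
theorem imitation_error_bound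
    {S A : Type*} [Fintype S] [Fintype A] [Nonempty S] [Nonempty A]
    (P : S → A → S → ℝ)
    (hP_nonneg : ∀ s a s', 0 ≤ P s a s')
    (hP_sum : ∀ s a, ∑ s', P s a s' = 1)
    (r : S → A → ℝ) (Rmax : ℝ) (hRmax : 0 < Rmax)
    (hr : ∀ s a, |r s a| ≤ Rmax)
    (γ : ℝ) (hγ0 : 0 ≤ γ) (hγ1 : γ < 1)
    (π π' : S → A → ℝ)
    (hπ_nonneg : ∀ s a, 0 ≤ π s a) (hπ_sum : ∀ s, ∑ a, π s a = 1)
    (hπ'_pos : ∀ s a, 0 < π' s a) (hπ'_sum : ∀ s, ∑ a, π' s a = 1)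
    (Vπ Vπ' : S → ℝ)
    (hV : ∀ s, Vπ s = ∑ a, π s a * (r s a + γ * ∑ s', P s a s' * Vπ s'))
    (hV' : ∀ s, Vπ' s = ∑ a, π' s a * (r s a + γ * ∑ s', P s a s' * Vπ' s'))
    (ρ0 : S → ℝ) (hρ0_nonneg : ∀ s, 0 ≤ ρ0 s) (hρ0_sum : ∑ s, ρ0 s = 1)
    (dπ : S → ℝ)
    (hd : ∀ s', dπ s' = (1 - γ) * ρ0 s' + γ * ∑ s, ∑ a, dπ s * π s a * P s a s')
    (ν : S → ℝ) (hν_nonneg : ∀ s, 0 ≤ ν s) (hν_sum : ∑ s, ν s = 1)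
    (M : ℝ) (hM : 0 < M)
    (hcov : ∀ s, dπ s ≤ M * ν s) :
    (∑ s, ρ0 s * Vπ' s) - (∑ s, ρ0 s * Vπ s) ≤
      Real.sqrt (2 * M) * Rmax / (1 - γ) ^ 2 *
        Real.sqrt (∑ s, ν s * KLdiv (π s) (π' s)) := by
  have hγ : 0 < 1 - γ := by linarith
  have hd_nonneg := occupancy_nonneg hP_nonneg hP_sum hγ0 hγ1 hπ_nonneg hπ_sum hρ0_nonneg
    hρ0_sum hd
  have hd_sum := occupancy_sum hP_sum hγ1 hπ_sum hρ0_sum hd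
  have hpinsker : ∀ s, (∑ a, |π s a - π' s a|) ^ 2 ≤ 2 * KLdiv (π s) (π' s) := fun s =>
    sq_sum_abs_sub_le_two_mul_KLdiv (hπ_nonneg s) (hπ'_pos s) (hπ_sum s) (hπ'_sum s)
  have hKL_nonneg : ∀ s, 0 ≤ KLdiv (π s) (π' s) := fun s => by
    linarith [hpinsker s, sq_nonneg (∑ a, |π s a - π' s a|)]
  have hV'_le := abs_value_le hP_nonneg hP_sum hr hγ0 hγ1 (fun s a => (hπ'_pos s a).le)
    hπ'_sum hV'
  have hQ : ∀ s a, |r s a + γ * ∑ s', P s a s' * Vπ' s'| ≤ Rmax / (1 - γ) := by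
    intro s a
    have h := abs_sum_mul_le_of_abs_le (hP_nonneg s a) (hP_sum s a) hV'_le
    calc |r s a + γ * ∑ s', P s a s' * Vπ' s'|
        ≤ |r s a| + γ * |∑ s', P s a s' * Vπ' s'| := by
          refine (abs_add_le _ _).trans_eq ?_
          rw [abs_mul, abs_of_nonneg hγ0]
      _ ≤ Rmax + γ * (Rmax / (1 - γ)) := add_le_add (hr s a) (mul_le_mul_of_nonneg_left h hγ0)
      _ = Rmax / (1 - γ) := by field_simp; ring
  have hadv : ∀ s, ∑ a, (π' s a - π s a) * (r s a + γ * ∑ s', P s a s' * Vπ' s') ≤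
      Rmax / (1 - γ) * ∑ a, |π s a - π' s a| := by
    intro s
    rw [Finset.mul_sum]
    refine Finset.sum_le_sum fun a _ => (le_abs_self _).trans ?_
    rw [abs_mul, abs_sub_comm, mul_comm]
    exact mul_le_mul_of_nonneg_right (hQ s a) (abs_nonneg _)
  have htv : ∑ s, dπ s * ∑ a, |π s a - π' s a| ≤
      Real.sqrt (2 * M) * Real.sqrt (∑ s, ν s * KLdiv (π s) (π' s)) := by
    rw [← Real.sqrt_mul (by positivity)]
    apply Real.le_sqrt_of_sq_le
    calc (∑ s, dπ s * ∑ a, |π s a - π' s a|) ^ 2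
        ≤ (∑ s, dπ s) * ∑ s, dπ s * (∑ a, |π s a - π' s a|) ^ 2 :=
          Finset.sum_sq_le_sum_mul_sum_of_sq_le_mul Finset.univ (fun s _ => hd_nonneg s)
            (fun s _ => mul_nonneg (hd_nonneg s) (sq_nonneg _)) (fun s _ => le_of_eq (by ring))
      _ = ∑ s, dπ s * (∑ a, |π s a - π' s a|) ^ 2 := by rw [hd_sum, one_mul]
      _ ≤ ∑ s, M * ν s * (2 * KLdiv (π s) (π' s)) := Finset.sum_le_sum fun s _ =>
          mul_le_mul (hcov s) (hpinsker s) (sq_nonneg _) ((hd_nonneg s).trans (hcov s))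
      _ = 2 * M * ∑ s, ν s * KLdiv (π s) (π' s) := by
          rw [Finset.mul_sum]
          exact Finset.sum_congr rfl fun s _ => by ring
  have hmain : (1 - γ) * (∑ s, ρ0 s * Vπ' s - ∑ s, ρ0 s * Vπ s) ≤
      Rmax / (1 - γ) *
        (Real.sqrt (2 * M) * Real.sqrt (∑ s, ν s * KLdiv (π s) (π' s))) := by
    rw [performance_difference hV hV' hd]
    calc _ ≤ ∑ s, dπ s * (Rmax / (1 - γ) * ∑ a, |π s a - π' s a|) :=
          Finset.sum_le_sum fun s _ => mul_le_mul_of_nonneg_left (hadv s) (hd_nonneg s)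
      _ = Rmax / (1 - γ) * ∑ s, dπ s * ∑ a, |π s a - π' s a| := by
          rw [Finset.mul_sum]
          exact Finset.sum_congr rfl fun s _ => by ring
      _ ≤ _ := mul_le_mul_of_nonneg_left htv (by positivity)
  rw [← le_div_iff₀' hγ] at hmain
  refine hmain.trans_eq ?_
  field_simp
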